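/- Let ε > 0, let λ > 0, and let g : [0,∞) → ℝ be continuous with |g(t)| < (2λ/3)·√(λ/3) for all t ≥ 0, with the strict inequality uniform (i.e., sup_{t≥0} |g(t)| < (2λ/3)·√(λ/3)). Then there is exactly one function u that is twice continuously differentiable and bounded on [0,∞), satisfies ε²·u''(t) = u(t)³ − λ·u(t) + g(t) for all t ≥ 0, satisfies u'(0) = 0, and satisfies u(t) > √(λ/3) for all t ≥ 0; and there is exactly one such bounded solution with u'(0) = 0 satisfying instead u(t) < −√(λ/3) for all t ≥ 0. -/

import Mathlib

open Real Set

/-- `u` is a bounded solution on `[0,∞)` of `ε²·u'' = u³ − λ·u + g` with `u'(0) = 0`. -/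
def IsBoundedSol (ε lam : ℝ) (g u : ℝ → ℝ) : Prop :=
  ContDiff ℝ 2 u ∧
  (∀ t ∈ Ici (0 : ℝ), ε ^ 2 * deriv (deriv u) t = u t ^ 3 - lam * u t + g t) ∧
  deriv u 0 = 0 ∧ (∃ M : ℝ, ∀ t ∈ Ici (0 : ℝ), |u t| ≤ M)

open MeasureTheory Filter Topology
open scoped BoundedContinuousFunction NNReal

/-- The one-sided exponential average `∫₀^∞ e^{-kr} w(t+r) dr`. -/
noncomputable def expAverage (k : ℝ) (w : ℝ → ℝ) (t : ℝ) : ℝ :=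
  ∫ r in Ioi (0 : ℝ), Real.exp (-k * r) * w (t + r)

lemma integrableOn_exp_neg_mul_bdd {k M : ℝ} (hk : 0 < k) {w : ℝ → ℝ} (hw : Continuous w)
    (hM : ∀ t, |w t| ≤ M) (c : ℝ) :
    IntegrableOn (fun r ↦ Real.exp (-k * r) * w r) (Ioi c) :=
  (exp_neg_integrableOn_Ioi c hk).mul_bdd hw.aestronglyMeasurable (.of_forall hM)

lemma integrableOn_expAverage {k M : ℝ} (hk : 0 < k) {w : ℝ → ℝ} (hw : Continuous w)
    (hM : ∀ t, |w t| ≤ M) (t : ℝ) :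
    IntegrableOn (fun r ↦ Real.exp (-k * r) * w (t + r)) (Ioi 0) :=
  integrableOn_exp_neg_mul_bdd hk (w := fun r ↦ w (t + r)) (by fun_prop) (fun _ ↦ hM _) 0

lemma expAverage_const {k : ℝ} (hk : 0 < k) (c t : ℝ) : expAverage k (fun _ ↦ c) t = c / k := by
  simp only [expAverage]
  rw [integral_mul_const, integral_exp_mul_Ioi (by linarith)]
  simp
  field_simp

lemma expAverage_mono {k M N : ℝ} (hk : 0 < k) {v w : ℝ → ℝ} (hv : Continuous v)
    (hw : Continuous w) (hM : ∀ t, |v t| ≤ M) (hN : ∀ t, |w t| ≤ N) (h : ∀ t, v t ≤ w t) (t : ℝ) :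
    expAverage k v t ≤ expAverage k w t :=
  integral_mono (integrableOn_expAverage hk hv hM t) (integrableOn_expAverage hk hw hN t)
    fun _ ↦ mul_le_mul_of_nonneg_left (h _) (Real.exp_pos _).le

lemma expAverage_add_const {k M : ℝ} (hk : 0 < k) {w : ℝ → ℝ} (hw : Continuous w)
    (hM : ∀ t, |w t| ≤ M) (c t : ℝ) :
    expAverage k (fun s ↦ w s + c) t = expAverage k w t + c / k := by
  rw [← expAverage_const hk c t]
  simp only [expAverage, mul_add]
  exact integral_add (integrableOn_expAverage hk hw hM t)
    (integrableOn_expAverage hk continuous_const (fun _ ↦ le_rfl) t)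

lemma expAverage_eq {k M : ℝ} (hk : 0 < k) {w : ℝ → ℝ} (hw : Continuous w)
    (hM : ∀ t, |w t| ≤ M) (t : ℝ) :
    expAverage k w t = Real.exp (k * t) *
      ((∫ r in Ioi (0 : ℝ), Real.exp (-k * r) * w r) - ∫ r in (0 : ℝ)..t,
        Real.exp (-k * r) * w r) := by
  have h1 := intervalIntegral.integral_interval_add_Ioi
    (integrableOn_exp_neg_mul_bdd hk hw hM 0) (integrableOn_exp_neg_mul_bdd hk hw hM t)
  have h2 := (measurePreserving_add_left volume t).setIntegral_preimage_emb
    (measurableEmbedding_addLeft t) (fun r ↦ Real.exp (-k * r) * w r) (Ioi t)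
  rw [← h1, add_sub_cancel_left, ← h2, ← integral_const_mul]
  have h3 : (fun x ↦ t + x) ⁻¹' Ioi t = Ioi 0 := by ext; simp
  rw [h3, expAverage]
  congr 1 with r
  rw [← mul_assoc, ← Real.exp_add]
  ring_nf

lemma hasDerivAt_expAverage {k M : ℝ} (hk : 0 < k) {w : ℝ → ℝ} (hw : Continuous w)
    (hM : ∀ t, |w t| ≤ M) (t : ℝ) :
    HasDerivAt (expAverage k w) (k * expAverage k w t - w t) t := by
  have hc : Continuous fun r ↦ Real.exp (-k * r) * w r := by fun_prop
  have h1 : HasDerivAt (fun t ↦ Real.exp (k * t)) (Real.exp (k * t) * k) t := by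
    simpa using ((hasDerivAt_id t).const_mul k).exp
  have h2 := h1.mul ((hc.integral_hasStrictDerivAt 0 t).hasDerivAt.const_sub
    (∫ r in Ioi (0 : ℝ), Real.exp (-k * r) * w r))
  rw [funext (expAverage_eq hk hw hM)]
  refine HasDerivAt.congr_deriv h2 ?_
  have h3 : Real.exp (k * t) * Real.exp (-k * t) = 1 := by
    rw [← Real.exp_add]; simp
  linear_combination -(w t) * h3

/-- The bounded solution of `u'' = k² u - w`. -/
noncomputable def green (k : ℝ) (w : ℝ → ℝ) (t : ℝ) : ℝ :=
  (expAverage k w t + expAverage k (fun s ↦ w (-s)) (-t)) / (2 * k)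

lemma green_le {k M β : ℝ} (hk : 0 < k) {w : ℝ → ℝ} (hw : Continuous w)
    (hM : ∀ t, |w t| ≤ M) (h : ∀ t, w t ≤ k ^ 2 * β) (t : ℝ) : green k w t ≤ β := by
  have h1 := expAverage_mono hk hw (continuous_const (y := k ^ 2 * β)) hM (fun _ ↦ le_rfl) h t
  have h2 := expAverage_mono hk (v := fun s ↦ w (-s)) (by fun_prop)
    (continuous_const (y := k ^ 2 * β)) (fun _ ↦ hM _) (fun _ ↦ le_rfl) (fun _ ↦ h _) (-t)
  rw [expAverage_const hk] at h1 h2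
  have h3 : k ^ 2 * β / k = k * β := by field_simp
  rw [green, div_le_iff₀ (by positivity)]
  linarith

lemma le_green {k M α : ℝ} (hk : 0 < k) {w : ℝ → ℝ} (hw : Continuous w)
    (hM : ∀ t, |w t| ≤ M) (h : ∀ t, k ^ 2 * α ≤ w t) (t : ℝ) : α ≤ green k w t := by
  have h1 := expAverage_mono hk (continuous_const (y := k ^ 2 * α)) hw (fun _ ↦ le_rfl) hM h t
  have h2 := expAverage_mono hk (w := fun s ↦ w (-s)) (continuous_const (y := k ^ 2 * α))
    (by fun_prop) (fun _ ↦ le_rfl) (fun _ ↦ hM _) (fun _ ↦ h _) (-t)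
  rw [expAverage_const hk] at h1 h2
  have h3 : k ^ 2 * α / k = k * α := by field_simp
  rw [green, le_div_iff₀ (by positivity)]
  linarith

lemma green_sub_le {k M N D : ℝ} (hk : 0 < k) {v w : ℝ → ℝ} (hv : Continuous v)
    (hw : Continuous w) (hM : ∀ t, |v t| ≤ M) (hN : ∀ t, |w t| ≤ N)
    (h : ∀ t, v t ≤ w t + D) (t : ℝ) : green k v t - green k w t ≤ D / k ^ 2 := by
  have hb : ∀ t, |w t + D| ≤ N + |D| := fun t ↦
    (abs_add_le _ _).trans (by linarith [hN t])
  have h1 := expAverage_mono hk hv (w := fun s ↦ w s + D) (by fun_prop) hM hb h t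
  have h2 := expAverage_mono hk (v := fun s ↦ v (-s)) (w := fun s ↦ w (-s) + D) (by fun_prop)
    (by fun_prop) (fun _ ↦ hM _) (fun _ ↦ hb _) (fun _ ↦ h _) (-t)
  rw [expAverage_add_const hk hw hN] at h1
  rw [expAverage_add_const hk (w := fun s ↦ w (-s)) (by fun_prop) (fun _ ↦ hN _)] at h2
  rw [green, green, ← sub_div, div_le_iff₀ (by positivity)]
  have h3 : D / k ^ 2 * (2 * k) = D / k + D / k := by field_simp; ring
  linarith

lemma hasDerivAt_expAverage_neg {k M : ℝ} (hk : 0 < k) {w : ℝ → ℝ} (hw : Continuous w)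
    (hM : ∀ t, |w t| ≤ M) (t : ℝ) :
    HasDerivAt (fun t ↦ expAverage k (fun s ↦ w (-s)) (-t))
      (w t - k * expAverage k (fun s ↦ w (-s)) (-t)) t := by
  have h := (hasDerivAt_expAverage hk (w := fun s ↦ w (-s)) (by fun_prop) (fun _ ↦ hM _)
    (-t)).comp t (hasDerivAt_neg t)
  exact h.congr_deriv (by simp)

lemma hasDerivAt_green {k M : ℝ} (hk : 0 < k) {w : ℝ → ℝ} (hw : Continuous w)
    (hM : ∀ t, |w t| ≤ M) (t : ℝ) :
    HasDerivAt (green k w)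
      ((expAverage k w t - expAverage k (fun s ↦ w (-s)) (-t)) / 2) t := by
  refine (((hasDerivAt_expAverage hk hw hM t).add
    (hasDerivAt_expAverage_neg hk hw hM t)).div_const (2 * k)).congr_deriv ?_
  field_simp
  ring

lemma hasDerivAt_deriv_green {k M : ℝ} (hk : 0 < k) {w : ℝ → ℝ} (hw : Continuous w)
    (hM : ∀ t, |w t| ≤ M) (t : ℝ) :
    HasDerivAt (deriv (green k w)) (k ^ 2 * green k w t - w t) t := by
  rw [funext fun t ↦ (hasDerivAt_green hk hw hM t).deriv]
  refine (((hasDerivAt_expAverage hk hw hM t).sub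
    (hasDerivAt_expAverage_neg hk hw hM t)).div_const 2).congr_deriv ?_
  rw [green]
  field_simp
  ring

lemma deriv_green_zero {k M : ℝ} (hk : 0 < k) {w : ℝ → ℝ} (hw : Continuous w)
    (hM : ∀ t, |w t| ≤ M) (he : ∀ t, w (-t) = w t) : deriv (green k w) 0 = 0 := by
  rw [(hasDerivAt_green hk hw hM 0).deriv]
  simp [he]

lemma contDiff_green {k M : ℝ} (hk : 0 < k) {w : ℝ → ℝ} (hw : Continuous w)
    (hM : ∀ t, |w t| ≤ M) : ContDiff ℝ 2 (green k w) := by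
  have hd : Differentiable ℝ (green k w) := fun t ↦ (hasDerivAt_green hk hw hM t).differentiableAt
  have hc := hd.continuous
  rw [show (2 : WithTop ℕ∞) = 1 + 1 by norm_num, contDiff_succ_iff_deriv]
  refine ⟨hd, by simp, ?_⟩
  rw [contDiff_one_iff_deriv]
  refine ⟨fun t ↦ (hasDerivAt_deriv_green hk hw hM t).differentiableAt, ?_⟩
  rw [funext fun t ↦ (hasDerivAt_deriv_green hk hw hM t).deriv]
  fun_prop

/-- The semilinear Neumann problem `u'' = k² u - f(t, u)` with `f` even in `t`, with values in
`[k² α, k² β]`, and with Lipschitz constant in `u` less than `k²`. -/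
lemma exists_even_bounded_solution {k α β L : ℝ} (hk : 0 < k) (hL : 0 ≤ L) (hLk : L < k ^ 2)
    {f : ℝ → ℝ → ℝ} (hf : Continuous fun p : ℝ × ℝ ↦ f p.1 p.2)
    (he : ∀ t x, f (-t) x = f t x) (hlip : ∀ t x y, f t x ≤ f t y + L * |x - y|)
    (hα : ∀ t x, k ^ 2 * α ≤ f t x) (hβ : ∀ t x, f t x ≤ k ^ 2 * β) :
    ∃ u : ℝ → ℝ, ContDiff ℝ 2 u ∧ deriv u 0 = 0 ∧ (∀ t, α ≤ u t) ∧ (∀ t, u t ≤ β) ∧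
      ∀ t, deriv (deriv u) t = k ^ 2 * u t - f t (u t) := by
  have hc : ∀ u : ℝ →ᵇ ℝ, Continuous fun t ↦ f t (u t) := fun u ↦
    hf.comp (continuous_id.prodMk u.continuous)
  obtain ⟨M, hM⟩ : ∃ M, ∀ t x, |f t x| ≤ M :=
    ⟨max |k ^ 2 * α| |k ^ 2 * β|, fun t x ↦ abs_le_max_abs_abs (hα t x) (hβ t x)⟩
  have hGα : ∀ (u : ℝ →ᵇ ℝ) t, α ≤ green k (fun s ↦ f s (u s)) t := fun u ↦
    le_green hk (hc u) (fun _ ↦ hM _ _) fun _ ↦ hα _ _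
  have hGβ : ∀ (u : ℝ →ᵇ ℝ) t, green k (fun s ↦ f s (u s)) t ≤ β := fun u ↦
    green_le hk (hc u) (fun _ ↦ hM _ _) fun _ ↦ hβ _ _
  let T : (ℝ →ᵇ ℝ) → (ℝ →ᵇ ℝ) := fun u ↦
    BoundedContinuousFunction.ofNormedAddCommGroup (green k fun s ↦ f s (u s))
      (contDiff_green hk (hc u) fun _ ↦ hM _ _).continuous (max |α| |β|)
      fun t ↦ abs_le_max_abs_abs (hGα u t) (hGβ u t)
  have hT : ∀ u t, T u t = green k (fun s ↦ f s (u s)) t := fun _ _ ↦ rfl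
  have key : ∀ (u v : ℝ →ᵇ ℝ) t, T u t - T v t ≤ L / k ^ 2 * dist u v := by
    intro u v t
    rw [hT, hT, div_mul_eq_mul_div]
    refine green_sub_le hk (hc u) (hc v) (fun _ ↦ hM _ _) (fun _ ↦ hM _ _) (fun s ↦ ?_) t
    have := mul_le_mul_of_nonneg_left (u.dist_coe_le_dist (g := v) s) hL
    rw [Real.dist_eq] at this
    linarith [hlip s (u s) (v s)]
  have hq : 0 ≤ L / k ^ 2 := by positivity
  have hcontr : ContractingWith (L / k ^ 2).toNNReal T := by
    refine ⟨?_, LipschitzWith.of_dist_le_mul fun u v ↦ ?_⟩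
    · rw [Real.toNNReal_lt_one, div_lt_one (by positivity)]
      exact hLk
    · rw [Real.coe_toNNReal _ hq, BoundedContinuousFunction.dist_le (by positivity)]
      intro t
      rw [Real.dist_eq, abs_le]
      have h1 := key u v t
      have h2 := key v u t
      rw [dist_comm v u] at h2
      constructor <;> linarith
  let u : ℝ →ᵇ ℝ := hcontr.fixedPoint
  have hfix : ⇑u = green k fun s ↦ f s (u s) :=
    congrArg DFunLike.coe hcontr.fixedPoint_isFixedPt.symm
  let v : ℝ →ᵇ ℝ := u.compContinuous ⟨fun t ↦ -t, continuous_neg⟩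
  have hv : ∀ t, v t = u (-t) := fun _ ↦ rfl
  have hvfix : T v = v := by
    ext t
    rw [hT, hv, hfix]
    simp only [green, hv, neg_neg]
    simp only [he]
    rw [add_comm]
  have huv : v = u := hcontr.fixedPoint_unique hvfix
  have heven : ∀ t, u (-t) = u t := fun t ↦ by rw [← hv, huv]
  refine ⟨u, ?_, ?_, fun t ↦ ?_, fun t ↦ ?_, fun t ↦ ?_⟩
  · rw [hfix]
    exact contDiff_green hk (hc u) fun _ ↦ hM _ _
  · rw [hfix]
    exact deriv_green_zero hk (hc u) (fun _ ↦ hM _ _) fun t ↦ by rw [heven, he]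
  · exact (hGα u t).trans_eq (congrFun hfix t).symm
  · exact (congrFun hfix t).trans_le (hGβ u t)
  · have h := (hasDerivAt_deriv_green hk (hc u) (fun _ ↦ hM _ _) t).deriv
    rwa [← hfix] at h

lemma abs_clamp_sub_clamp_le (a b x y : ℝ) :
    |max a (min b x) - max a (min b y)| ≤ |x - y| := by
  have h1 := abs_max_sub_max_le_max a (min b x) a (min b y)
  have h2 := abs_min_sub_min_le_max b x b y
  simp only [sub_self, abs_zero, abs_nonneg, max_eq_right] at h1 h2
  exact h1.trans h2

lemma exists_solution_above {ε lam C : ℝ} {g : ℝ → ℝ} (hε : 0 < ε) (hlam : 0 < lam)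
    (hg : ContinuousOn g (Ici (0 : ℝ))) (hC : ∀ t ∈ Ici (0 : ℝ), |g t| ≤ C)
    (hC' : C < (2 * lam / 3) * Real.sqrt (lam / 3)) :
    ∃ u : ℝ → ℝ, IsBoundedSol ε lam g u ∧ ∀ t ∈ Ici (0 : ℝ), Real.sqrt (lam / 3) < u t := by
  set s := Real.sqrt (lam / 3) with hs
  have hs0 : 0 < s := Real.sqrt_pos.2 (by positivity)
  have hs2 : s ^ 2 = lam / 3 := Real.sq_sqrt (by positivity)
  have hC0 : 0 ≤ C := (abs_nonneg _).trans (hC 0 self_mem_Ici)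
  obtain ⟨a, hsa, haC⟩ : ∃ a, s < a ∧ a ^ 3 - lam * a + C < 0 := by
    have hcont : Continuous fun x : ℝ ↦ x ^ 3 - lam * x + C := by fun_prop
    have hneg : s ^ 3 - lam * s + C < 0 := by
      have : s ^ 3 = lam / 3 * s := by rw [← hs2]; ring
      rw [this]; linarith
    have h1 := (hcont.tendsto s).eventually_lt_const hneg
    obtain ⟨a, ha⟩ := ((h1.filter_mono nhdsWithin_le_nhds).and
      (self_mem_nhdsWithin (s := Ioi s))).exists
    exact ⟨a, ha.2, ha.1⟩
  have ha0 : 0 < a := hs0.trans hsa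
  have hm : lam < 3 * a ^ 2 := by nlinarith
  obtain ⟨b, hab, hbC⟩ : ∃ b, a ≤ b ∧ C ≤ b ^ 3 - lam * b := by
    refine ⟨a + lam + C + 1, by linarith, ?_⟩
    set b := a + lam + C + 1 with hb
    have h1 : C ≤ b ^ 2 - lam := by nlinarith
    nlinarith
  have hK : 0 < 3 * b ^ 2 := by nlinarith
  set c : ℝ → ℝ := fun x ↦ max a (min b x) with hcdef
  have hca : ∀ x, a ≤ c x := fun x ↦ le_max_left _ _
  have hcb : ∀ x, c x ≤ b := fun x ↦ max_le hab (min_le_left _ _)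
  have hccont : Continuous c := by fun_prop
  set k := Real.sqrt (3 * b ^ 2) / ε with hkdef
  have hk : 0 < k := div_pos (Real.sqrt_pos.2 hK) hε
  have hk2 : k ^ 2 = 3 * b ^ 2 / ε ^ 2 := by
    rw [hkdef, div_pow, Real.sq_sqrt hK.le]
  have hgabs : Continuous fun t ↦ g |t| :=
    hg.comp_continuous continuous_abs fun t ↦ abs_nonneg t
  have hgC : ∀ t, -C ≤ g |t| ∧ g |t| ≤ C := fun t ↦ abs_le.1 (hC _ (abs_nonneg t))
  have hmono : ∀ x y, a ≤ x → x ≤ y → y ≤ b →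
      3 * b ^ 2 * x - (x ^ 3 - lam * x) ≤ 3 * b ^ 2 * y - (y ^ 3 - lam * y) := by
    intro x y hx hxy hy
    have h1 : x ^ 2 + x * y + y ^ 2 ≤ 3 * b ^ 2 := by nlinarith
    nlinarith [mul_nonneg (sub_nonneg.2 hxy) (sub_nonneg.2 h1)]
  have hlipc : ∀ x y, a ≤ x → a ≤ y → x ≤ b → y ≤ b →
      3 * b ^ 2 * x - (x ^ 3 - lam * x) ≤ 3 * b ^ 2 * y - (y ^ 3 - lam * y) +
        (3 * b ^ 2 - (3 * a ^ 2 - lam)) * |x - y| := by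
    intro x y hx hy hxb hyb
    rcases le_total x y with h | h
    · have h1 := hmono x y hx h hyb
      have h2 : 0 ≤ (3 * b ^ 2 - (3 * a ^ 2 - lam)) * |x - y| :=
        mul_nonneg (by nlinarith) (abs_nonneg _)
      linarith
    · rw [abs_of_nonneg (sub_nonneg.2 h)]
      have h1 : 3 * a ^ 2 ≤ x ^ 2 + x * y + y ^ 2 := by nlinarith
      nlinarith [mul_nonneg (sub_nonneg.2 h) (sub_nonneg.2 h1)]
  obtain ⟨u, hu, hu0, hua, hub, hode⟩ := exists_even_bounded_solution (α := a) (β := b)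
    (L := (3 * b ^ 2 - (3 * a ^ 2 - lam)) / ε ^ 2)
    (f := fun t x ↦ (3 * b ^ 2 * c x - (c x ^ 3 - lam * c x) - g |t|) / ε ^ 2) hk
    (div_nonneg (by nlinarith) (by positivity))
    (by rw [hk2]; gcongr; linarith)
    (by
      have h1 : Continuous fun p : ℝ × ℝ ↦ g |p.1| := hgabs.comp continuous_fst
      exact ((by fun_prop : Continuous fun p : ℝ × ℝ ↦
        3 * b ^ 2 * c p.2 - (c p.2 ^ 3 - lam * c p.2)).sub h1).div_const _)
    (fun t x ↦ by simp only [abs_neg])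
    (fun t x y ↦ by
      rw [div_mul_eq_mul_div, ← add_div]
      have h1 := hlipc (c x) (c y) (hca x) (hca y) (hcb x) (hcb y)
      have h2 : (3 * b ^ 2 - (3 * a ^ 2 - lam)) * |c x - c y| ≤
          (3 * b ^ 2 - (3 * a ^ 2 - lam)) * |x - y| :=
        mul_le_mul_of_nonneg_left (abs_clamp_sub_clamp_le a b x y) (by nlinarith)
      gcongr
      linarith)
    (fun t x ↦ by
      rw [hk2, div_mul_eq_mul_div]
      gcongr
      linarith [hmono a (c x) le_rfl (hca x) (hcb x), (hgC t).2])
    (fun t x ↦ by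
      rw [hk2, div_mul_eq_mul_div]
      gcongr
      linarith [hmono (c x) b (hca x) (hcb x) le_rfl, (hgC t).1])
  refine ⟨u, ⟨hu, fun t ht ↦ ?_, hu0, b, fun t _ ↦ ?_⟩, fun t _ ↦ hsa.trans_le (hua t)⟩
  · have h1 : c (u t) = u t := by
      simp only [hcdef]
      rw [min_eq_right (hub t), max_eq_right (hua t)]
    rw [hode, h1, abs_of_nonneg ht, hk2]
    field_simp
    ring
  · rw [abs_of_pos (ha0.trans_le (hua t))]
    exact hub t

/-- A bounded solution of `z'' = q z` on `[0,∞)` with `q > 0` and `z'(0) = 0` vanishes. -/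
lemma eq_zero_of_bounded_of_deriv_zero {z z' q : ℝ → ℝ} {M : ℝ}
    (hz : ∀ t ∈ Ici (0 : ℝ), HasDerivAt z (z' t) t)
    (hz' : ∀ t ∈ Ici (0 : ℝ), HasDerivAt z' (q t * z t) t)
    (hq : ∀ t ∈ Ici (0 : ℝ), 0 < q t) (h0 : z' 0 = 0)
    (hM : ∀ t ∈ Ici (0 : ℝ), |z t| ≤ M) : ∀ t ∈ Ici (0 : ℝ), z t = 0 := by
  have hy : ∀ t ∈ Ici (0 : ℝ), HasDerivAt (fun t ↦ z t * z' t) (z' t ^ 2 + q t * z t ^ 2) t := by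
    intro t ht
    refine ((hz t ht).mul (hz' t ht)).congr_deriv ?_
    ring
  have hmono : MonotoneOn (fun t ↦ z t * z' t) (Ici 0) := by
    refine monotoneOn_of_deriv_nonneg (convex_Ici 0)
      (fun t ht ↦ (hy t ht).continuousAt.continuousWithinAt)
      (fun t ht ↦ (hy t (interior_subset ht)).differentiableAt.differentiableWithinAt)
      fun t ht ↦ ?_
    have ht' := interior_subset ht
    rw [(hy t ht').deriv]
    have := hq t ht'
    positivity
  have hyz : ∀ t ∈ Ici (0 : ℝ), z t * z' t = 0 := by
    intro t₀ ht₀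
    have hge : 0 ≤ z t₀ * z' t₀ := by
      simpa [h0] using hmono self_mem_Ici ht₀ (mem_Ici.1 ht₀)
    by_contra hne
    have hpos : 0 < z t₀ * z' t₀ := lt_of_le_of_ne hge (Ne.symm hne)
    set δ := z t₀ * z' t₀ with hδ
    have hd : ∀ t ∈ Ici t₀, HasDerivAt (fun t ↦ z t ^ 2 - 2 * δ * t)
        (2 * (z t * z' t) - 2 * δ) t := by
      intro t ht
      have ht0 : t ∈ Ici (0 : ℝ) := le_trans (mem_Ici.1 ht₀) ht
      refine (((hz t ht0).pow 2).sub ((hasDerivAt_id t).const_mul (2 * δ))).congr_deriv ?_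
      simp
      ring
    have hgrow : MonotoneOn (fun t ↦ z t ^ 2 - 2 * δ * t) (Ici t₀) := by
      refine monotoneOn_of_deriv_nonneg (convex_Ici t₀)
        (fun t ht ↦ (hd t ht).continuousAt.continuousWithinAt)
        (fun t ht ↦ (hd t (interior_subset ht)).differentiableAt.differentiableWithinAt)
        fun t ht ↦ ?_
      have ht' := interior_subset ht
      rw [(hd t ht').deriv]
      have : z t₀ * z' t₀ ≤ z t * z' t :=
        hmono ht₀ (le_trans (mem_Ici.1 ht₀) ht') (mem_Ici.1 ht')
      linarith
    have hstep : 0 ≤ (M ^ 2 + 1) / (2 * δ) := by positivity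
    have h1 : z t₀ ^ 2 - 2 * δ * t₀ ≤ z (t₀ + (M ^ 2 + 1) / (2 * δ)) ^ 2 -
        2 * δ * (t₀ + (M ^ 2 + 1) / (2 * δ)) :=
      hgrow self_mem_Ici (by simpa using hstep) (by simpa using hstep)
    have h2 : 2 * δ * (t₀ + (M ^ 2 + 1) / (2 * δ)) = 2 * δ * t₀ + (M ^ 2 + 1) := by
      field_simp
    have h3 : z (t₀ + (M ^ 2 + 1) / (2 * δ)) ^ 2 ≤ M ^ 2 :=
      sq_le_sq' (abs_le.1 (hM _ (add_nonneg ht₀ hstep))).1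
        (abs_le.1 (hM _ (add_nonneg ht₀ hstep))).2
    nlinarith [sq_nonneg (z t₀)]
  intro t ht
  have h1 : HasDerivWithinAt (fun t ↦ z t * z' t) 0 (Ici 0) t :=
    (hasDerivWithinAt_const t (Ici 0) (0 : ℝ)).congr hyz (hyz t ht)
  have h2 := (uniqueDiffOn_Ici (0 : ℝ) t ht).eq_deriv _ (hy t ht).hasDerivWithinAt h1
  have h3 := hq t ht
  have h4 : q t * z t ^ 2 = 0 := by
    have : 0 ≤ q t * z t ^ 2 := by positivity
    nlinarith [sq_nonneg (z' t)]
  simpa [h3.ne'] using h4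

lemma IsBoundedSol.hasDerivAt {ε lam : ℝ} {g u : ℝ → ℝ} (h : IsBoundedSol ε lam g u) (t : ℝ) :
    HasDerivAt u (deriv u t) t :=
  (h.1.differentiable (by norm_num) t).hasDerivAt

lemma IsBoundedSol.hasDerivAt_deriv {ε lam : ℝ} {g u : ℝ → ℝ} (h : IsBoundedSol ε lam g u)
    (t : ℝ) : HasDerivAt (deriv u) (deriv (deriv u) t) t := by
  have h1 := h.1
  rw [show (2 : WithTop ℕ∞) = 1 + 1 by norm_num, contDiff_succ_iff_deriv] at h1
  exact (h1.2.2.differentiable (by norm_num) t).hasDerivAt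

lemma IsBoundedSol.eq_of_above {ε lam : ℝ} {g u v : ℝ → ℝ} (hε : 0 < ε) (hlam : 0 < lam)
    (hu : IsBoundedSol ε lam g u) (hv : IsBoundedSol ε lam g v)
    (hus : ∀ t ∈ Ici (0 : ℝ), Real.sqrt (lam / 3) < u t)
    (hvs : ∀ t ∈ Ici (0 : ℝ), Real.sqrt (lam / 3) < v t) : ∀ t ∈ Ici (0 : ℝ), v t = u t := by
  have hs0 : 0 < Real.sqrt (lam / 3) := Real.sqrt_pos.2 (by positivity)
  have hs2 : Real.sqrt (lam / 3) ^ 2 = lam / 3 := Real.sq_sqrt (by positivity)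
  obtain ⟨M, hM⟩ := hu.2.2.2
  obtain ⟨N, hN⟩ := hv.2.2.2
  have h := eq_zero_of_bounded_of_deriv_zero (z := fun t ↦ v t - u t)
    (z' := fun t ↦ deriv v t - deriv u t)
    (q := fun t ↦ (v t ^ 2 + v t * u t + u t ^ 2 - lam) / ε ^ 2) (M := N + M)
    (fun t _ ↦ (hv.hasDerivAt t).sub (hu.hasDerivAt t))
    (fun t ht ↦ by
      refine ((hv.hasDerivAt_deriv t).sub (hu.hasDerivAt_deriv t)).congr_deriv ?_
      have h1 := hu.2.1 t ht
      have h2 := hv.2.1 t ht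
      field_simp
      linear_combination h2 - h1)
    (fun t ht ↦ by
      have h1 := hus t ht
      have h2 := hvs t ht
      refine div_pos ?_ (by positivity)
      nlinarith)
    (by rw [hu.2.2.1, hv.2.2.1, sub_zero])
    (fun t ht ↦ (abs_sub _ _).trans (add_le_add (hN t ht) (hM t ht)))
  exact fun t ht ↦ sub_eq_zero.1 (h t ht)

lemma IsBoundedSol.neg {ε lam : ℝ} {g u : ℝ → ℝ} (h : IsBoundedSol ε lam g u) :
    IsBoundedSol ε lam (fun t ↦ -g t) fun t ↦ -u t := by
  have hd : deriv (fun t ↦ -u t) = fun t ↦ -deriv u t := funext fun t ↦ (h.hasDerivAt t).neg.deriv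
  refine ⟨h.1.neg, fun t ht ↦ ?_, ?_, ?_⟩
  · have h1 : deriv (fun t ↦ -deriv u t) t = -deriv (deriv u) t :=
      (h.hasDerivAt_deriv t).neg.deriv
    rw [hd, h1]
    linear_combination -h.2.1 t ht
  · simp [hd, h.2.2.1]
  · simpa using h.2.2.2

/-- For `ε > 0`, `λ > 0` and continuous `g` with `sup |g| < (2λ/3)·√(λ/3)` on `[0,∞)`,
there is exactly one bounded solution with `u'(0)=0` staying above `√(λ/3)`,
and exactly one staying below `−√(λ/3)`. -/
theorem stmt_2 (ε lam : ℝ) (hε : 0 < ε) (hlam : 0 < lam) (g : ℝ → ℝ)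
    (hg_cont : ContinuousOn g (Ici (0 : ℝ)))
    (hg_bdd : ∃ C : ℝ, (∀ t ∈ Ici (0 : ℝ), |g t| ≤ C) ∧
      C < (2 * lam / 3) * Real.sqrt (lam / 3)) :
    (∃ u : ℝ → ℝ,
      (IsBoundedSol ε lam g u ∧ ∀ t ∈ Ici (0 : ℝ), Real.sqrt (lam / 3) < u t) ∧
      ∀ v : ℝ → ℝ,
        (IsBoundedSol ε lam g v ∧ ∀ t ∈ Ici (0 : ℝ), Real.sqrt (lam / 3) < v t) →
        ∀ t ∈ Ici (0 : ℝ), v t = u t) ∧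
    (∃ u : ℝ → ℝ,
      (IsBoundedSol ε lam g u ∧ ∀ t ∈ Ici (0 : ℝ), u t < -Real.sqrt (lam / 3)) ∧
      ∀ v : ℝ → ℝ,
        (IsBoundedSol ε lam g v ∧ ∀ t ∈ Ici (0 : ℝ), v t < -Real.sqrt (lam / 3)) →
        ∀ t ∈ Ici (0 : ℝ), v t = u t) := by
  obtain ⟨C, hC, hC'⟩ := hg_bdd
  constructor
  · obtain ⟨u, hu, hus⟩ := exists_solution_above hε hlam hg_cont hC hC'
    exact ⟨u, ⟨hu, hus⟩, fun v hv ↦ hu.eq_of_above hε hlam hv.1 hus hv.2⟩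
  · obtain ⟨u, hu, hus⟩ := exists_solution_above (g := fun t ↦ -g t) hε hlam hg_cont.neg
      (by simpa using hC) hC'
    refine ⟨fun t ↦ -u t, ⟨by simpa using hu.neg, fun t ht ↦ neg_lt_neg (hus t ht)⟩, ?_⟩
    intro v hv t ht
    have h := hu.eq_of_above hε hlam hv.1.neg hus (fun t ht ↦ lt_neg.1 (hv.2 t ht)) t ht
    linarith
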